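/- Let p be an odd prime, q = p^m, and let b, c ∈ F_{q²} with N(b) ≠ N(c). Let k be an integer with 0 < k < m and set ℓ(x) = (b·x^q + c·x)^{p^k} and f(x) = x^{q+1} + ℓ(x²). Then f is a planar function on F_{q²} if and only if p^k ≡ 1 (mod 4), m = 2k, and N(b − c^q)^{(p^k+1)/2} = −(N(b) − N(c))^{p^k+1}. -/

import Mathlib

theorem Choose.choose_modEq_choose_mod_pow_mul_choose_div_pow {p : ℕ} [Fact p.Prime] (g : ℕ) :
    ∀ n k : ℕ, n.choose k ≡
      (n % p ^ g).choose (k % p ^ g) * (n / p ^ g).choose (k / p ^ g) [MOD p] := by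
  induction g with
  | zero => intro n k; simp [Nat.mod_one, Nat.ModEq.refl]
  | succ g ih =>
    intro n k
    have h1 := Choose.choose_modEq_choose_mod_mul_choose_div_nat (n := n) (k := k) (p := p)
    have h2 := ih (n / p) (k / p)
    have h3 := Choose.choose_modEq_choose_mod_mul_choose_div_nat
      (n := n % p ^ (g + 1)) (k := k % p ^ (g + 1)) (p := p)
    rw [pow_succ', Nat.mod_mul_right_div_self, Nat.mod_mul_right_div_self,
      Nat.mod_mul_right_mod, Nat.mod_mul_right_mod] at h3
    rw [pow_succ', ← Nat.div_div_eq_div_mul, ← Nat.div_div_eq_div_mul]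
    refine h1.trans ((h2.mul_left _).trans ?_)
    rw [← mul_assoc]
    exact h3.symm.mul_right _

theorem geom_sum_dvd_of_pow_sub_one_dvd {x t r a : ℕ} (hx : 0 < x) (hrt : r.Coprime t)
    (h : (x + 1) ^ t - 1 ∣ 2 * ((x + 1) ^ r - 1) * a) :
    ∑ i ∈ Finset.range t, (x + 1) ^ i ∣ 2 * a := by
  have ht := geom_sum_mul_add x t
  have hr := geom_sum_mul_add x r
  have hgcd := Nat.pow_sub_one_gcd_pow_sub_one (x + 1) r t
  rw [Nat.Coprime.gcd_eq_one hrt, ← ht, ← hr] at hgcd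
  rw [← ht, ← hr] at h
  simp only [Nat.add_sub_cancel, pow_one] at h hgcd
  set R := ∑ i ∈ Finset.range t, (x + 1) ^ i
  set S := ∑ i ∈ Finset.range r, (x + 1) ^ i
  have hcop : R.Coprime S := by
    rw [Nat.gcd_mul_right] at hgcd
    rw [Nat.coprime_comm]
    exact Nat.eq_of_mul_eq_mul_right hx (by rw [hgcd, one_mul])
  have h' : R * x ∣ (S * (2 * a)) * x := by
    convert h using 1; ring
  exact hcop.dvd_of_dvd_mul_left (Nat.dvd_of_mul_dvd_mul_right hx h')

theorem exists_geom_sum_eq_mul_add_one {x t : ℕ} (ht : 0 < t) :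
    ∃ a, ∑ i ∈ Finset.range t, x ^ i = a * x + 1 := by
  obtain ⟨s, rfl⟩ := Nat.exists_eq_succ_of_ne_zero ht.ne'
  refine ⟨∑ i ∈ Finset.range s, x ^ i, ?_⟩
  rw [Finset.sum_range_succ', Finset.sum_mul]
  simp [pow_succ]

/-- With `P = 2h + 1` a power of `p` and `R = 1 + P + ⋯ + P^(t-1)`, the binomial coefficient
`(h * R).choose h` is the only one of its residue class modulo `R / 2` that `p` may fail
to divide, as soon as `t ≥ 3`. -/
theorem dvd_choose_of_geom_sum_dvd {p g h t i : ℕ} [Fact p.Prime] (hP : p ^ g = 2 * h + 1)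
    (hh : 0 < h) (ht : 3 ≤ t) {R : ℕ} (hR : R = ∑ i ∈ Finset.range t, (2 * h + 1) ^ i)
    (hi : i ≤ h * R) (hne : i ≠ h) (hdvd : (R : ℤ) ∣ 2 * ((i : ℤ) - h)) :
    p ∣ (h * R).choose i := by
  have key : ∀ n k, n % p ^ g < k % p ^ g → p ∣ n.choose k := fun n k hnk => by
    have := Choose.choose_modEq_choose_mod_pow_mul_choose_div_pow (p := p) g n k
    rw [Nat.choose_eq_zero_of_lt hnk, zero_mul] at this
    exact (Nat.modEq_zero_iff_dvd).1 this
  have hbig : ∀ a b c d : ℕ, b < 2 * h + 1 → d < 2 * h + 1 → d < b →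
      (c * (2 * h + 1) + d) % p ^ g < (a * (2 * h + 1) + b) % p ^ g := by
    intro a b c d hb hd hdb
    rw [hP, Nat.mul_add_mod_of_lt hb, Nat.mul_add_mod_of_lt hd]
    exact hdb
  obtain ⟨R', hR'⟩ : ∃ R', R = R' * (2 * h + 1) + 1 :=
    hR ▸ exists_geom_sum_eq_mul_add_one (by omega)
  have hRbig : h < R := by
    have : R' ≠ 0 := by
      rintro rfl
      have h2 : ∑ i ∈ Finset.range 2, (2 * h + 1) ^ i ≤ R := by
        rw [hR]
        exact Finset.sum_le_sum_of_subset (Finset.range_subset_range.2 (by omega))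
      simp [Finset.sum_range_succ] at h2
      omega
    have : 1 ≤ R' := Nat.one_le_iff_ne_zero.2 this
    nlinarith
  obtain ⟨w, hw⟩ := hdvd
  rcases Int.even_or_odd' w with ⟨z, rfl | rfl⟩
  · have hz : (i : ℤ) = h + R * z := by linarith
    have hz0 : 0 ≤ z := by
      by_contra! hneg
      have : (R : ℤ) * z ≤ R * (-1) := mul_le_mul_of_nonneg_left (by omega) (by positivity)
      omega
    lift z to ℕ using hz0
    norm_cast at hz
    subst hz
    have hz1 : z ≠ 0 := by rintro rfl; simp at hne
    have hzh : z < h := by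
      by_contra! hle
      have := Nat.mul_le_mul_right R hle
      rw [mul_comm z R] at this
      omega
    have e1 : h * R = (h * R') * (2 * h + 1) + h := by rw [hR']; ring
    have e2 : h + R * z = (z * R') * (2 * h + 1) + (h + z) := by rw [hR']; ring
    apply key
    rw [e1, e2]
    exact hbig _ _ _ _ (by omega) (by omega) (by omega)
  · have hsum : ∀ s, ∑ i ∈ Finset.range (2 * s), (2 * h + 1) ^ i =
        2 * (h + 1) * ∑ i ∈ Finset.range s, ((2 * h + 1) ^ 2) ^ i := by
      intro s
      induction s with
      | zero => simp
      | succ s ih =>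
        rw [show 2 * (s + 1) = 2 * s + 1 + 1 by ring, Finset.sum_range_succ,
          Finset.sum_range_succ, ih, Finset.sum_range_succ, ← pow_mul _ 2 s]
        ring
    rcases Nat.even_or_odd' t with ⟨s, rfl | rfl⟩
    · obtain ⟨s, rfl⟩ : ∃ s', s = s' + 1 + 1 := ⟨s - 2, by omega⟩
      rw [hsum, Finset.sum_range_succ', Finset.sum_range_succ'] at hR
      set V := ∑ i ∈ Finset.range s, ((2 * h + 1) ^ 2) ^ (i + 1 + 1)
      obtain ⟨U, hU⟩ : ∃ U, V = (2 * h + 1) ^ 2 * ((2 * h + 1) * U) := by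
        refine ⟨(2 * h + 1) * ∑ i ∈ Finset.range s, ((2 * h + 1) ^ 2) ^ i, ?_⟩
        simp only [V, Finset.mul_sum]
        refine Finset.sum_congr rfl fun i _ => by ring
      have hR2 : R = 2 * ((h + 1) * (1 + (2 * h + 1) ^ 2 * ((2 * h + 1) * U + 1))) := by
        rw [hR, hU]; ring
      set T := (h + 1) * (1 + (2 * h + 1) ^ 2 * ((2 * h + 1) * U + 1)) with hT
      have hz : (i : ℤ) = h + T + R * z := by
        have : (R : ℤ) = 2 * T := by exact_mod_cast hR2
        rw [this] at hw ⊢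
        linarith
      have hTh : h < T := by
        have : h + 1 ≤ T := Nat.le_mul_of_pos_right _ (by positivity)
        omega
      have hz0 : 0 ≤ z := by
        by_contra! hneg
        have : (R : ℤ) * z ≤ R * (-1) := mul_le_mul_of_nonneg_left (by omega) (by positivity)
        omega
      lift z to ℕ using hz0
      norm_cast at hz
      have hzh : z < h := by
        by_contra! hle
        have := Nat.mul_le_mul_right R hle
        rw [mul_comm z R] at this
        omega
      have hPP : p ^ (g * 2) = (2 * h + 1) ^ 2 := by rw [pow_mul, hP]
      have hlt : z + (z + 1) * (2 * h + 1) < (2 * h + 1) ^ 2 := by nlinarith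
      have hlt' : h + h * (2 * h + 1) < (2 * h + 1) ^ 2 := by nlinarith
      have e1 : h * R / (2 * h + 1) ^ 2 =
          (h * (2 * h + 2) * U + h) * (2 * h + 1) + h := by
        have : h * R = (2 * h + 1) ^ 2 * ((h * (2 * h + 2) * U + h) * (2 * h + 1) + h) +
            (h + h * (2 * h + 1)) := by rw [hR2, hT]; ring
        rw [this, Nat.mul_add_div (by positivity), Nat.div_eq_of_lt hlt', add_zero]
      have e2 : i / (2 * h + 1) ^ 2 =
          (U * (h + 1 + z + z * (2 * h + 1)) + z) * (2 * h + 1) + (h + 1 + z) := by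
        have : i = (2 * h + 1) ^ 2 *
            ((U * (h + 1 + z + z * (2 * h + 1)) + z) * (2 * h + 1) + (h + 1 + z)) +
            (z + (z + 1) * (2 * h + 1)) := by rw [hz, hR2, hT]; ring
        rw [this, Nat.mul_add_div (by positivity), Nat.div_eq_of_lt hlt, add_zero]
      have hL := Choose.choose_modEq_choose_mod_pow_mul_choose_div_pow (p := p) (g * 2) (h * R) i
      have hd : p ∣ (h * R / p ^ (g * 2)).choose (i / p ^ (g * 2)) := by
        apply key
        rw [hPP, e1, e2]
        exact hbig _ _ _ _ (by omega) (by omega) (by omega)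
      exact (Nat.modEq_zero_iff_dvd).1
        (hL.trans ((Nat.modEq_zero_iff_dvd).2 (hd.mul_left _)))
    · exfalso
      rw [Finset.sum_range_succ, hsum] at hR
      have h1 : Odd R := by
        rw [hR]
        exact Even.add_odd (mul_assoc 2 _ _ ▸ even_two_mul _) (Odd.pow ⟨h, rfl⟩)
      have h2 : Odd ((R : ℤ) * (2 * z + 1)) :=
        Odd.mul (by exact_mod_cast h1) ⟨z, rfl⟩
      rw [← hw] at h2
      exact (Int.not_odd_iff_even.2 ⟨_, two_mul _⟩) h2

namespace FiniteField

variable {F : Type*} [Field F] [Fintype F]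

theorem exists_pow_eq_of_pow_eq_one {a b : ℕ} (hab : Fintype.card F - 1 = a * b) {w : F}
    (hw : w ^ a = 1) : ∃ e : F, e ≠ 0 ∧ e ^ b = w := by
  classical
  have hpos : 0 < a * b := hab ▸ Nat.sub_pos_of_lt Fintype.one_lt_card
  have ha : 0 < a := Nat.pos_of_mul_pos_right hpos
  have hw0 : w ≠ 0 := by rintro rfl; simp [ha.ne'] at hw
  obtain ⟨η, hη⟩ := IsCyclic.exists_generator (α := Fˣ)
  obtain ⟨j, hj⟩ := (mem_powers_iff_mem_zpowers.2 (hη (Units.mk0 w hw0)))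
  have hord : orderOf η = a * b := by
    rw [orderOf_eq_card_of_forall_mem_zpowers hη, Nat.card_eq_fintype_card,
      Fintype.card_units, hab]
  have hdvd : a * b ∣ j * a := by
    rw [← hord, orderOf_dvd_iff_pow_eq_one, pow_mul]
    simp only at hj
    rw [hj]
    ext
    simpa using hw
  obtain ⟨c, rfl⟩ : b ∣ j := Nat.dvd_of_mul_dvd_mul_left ha (mul_comm j a ▸ hdvd)
  refine ⟨((η ^ c : Fˣ) : F), Units.ne_zero _, ?_⟩
  have := congrArg Units.val hj
  rw [← Units.val_pow_eq_pow_val, ← pow_mul, mul_comm c b]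
  simpa using this

open Polynomial in
/-- A polynomial that agrees with `X ^ l` on the `E`-th powers of the units is congruent to
`X ^ l` modulo the polynomial vanishing on these, which reads off on the coefficients. -/
theorem sum_coeff_of_eval_pow_eq {T : F[X]} {L E l : ℕ} (hL : T.natDegree < L)
    (h : ∀ u : F, u ≠ 0 → T.eval (u ^ E) = (u ^ E) ^ l) (j : ℕ) :
    (∑ i ∈ Finset.range L, if Fintype.card F - 1 ∣ E * (i + j) then T.coeff i else 0) =
      if Fintype.card F - 1 ∣ E * (l + j) then 1 else 0 := by
  classical
  have key : ∑ u : Fˣ, T.eval ((u : F) ^ E) * ((u : F) ^ E) ^ j =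
      ∑ u : Fˣ, (u : F) ^ (E * (l + j)) :=
    Finset.sum_congr rfl fun u _ => by
      rw [h _ u.ne_zero, ← pow_add, ← pow_mul]
  simp_rw [eval_eq_sum_range' hL, Finset.sum_mul] at key
  rw [Finset.sum_comm] at key
  have h1 : ∀ i, ∑ u : Fˣ, T.coeff i * ((u : F) ^ E) ^ i * ((u : F) ^ E) ^ j =
      -(if Fintype.card F - 1 ∣ E * (i + j) then T.coeff i else 0) := by
    intro i
    simp_rw [mul_assoc, ← pow_add, ← pow_mul, ← Finset.mul_sum, sum_pow_units]
    split_ifs <;> simp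
  simp_rw [h1, sum_pow_units, Finset.sum_neg_distrib] at key
  rw [← neg_inj, key]
  split_ifs <;> simp

open Polynomial in
theorem eq_two_mul_of_forall_pow_eq_one {p m k : ℕ} [Fact p.Prime] (hodd : Odd p)
    (hk0 : 0 < k) (hkm : k < m) (hF : Fintype.card F = (p ^ m) ^ 2) {n : F} (hn : n ≠ 0)
    (H : ∀ s : F, s ≠ 0 → s ^ p ^ m = s →
      (s ^ (2 * (p ^ k - 1)) - n) ^ ((p ^ m - 1) / 2) = 1) : m = 2 * k := by
  have hp := Fact.out (p := p.Prime)
  have : CharP F p := charP_of_card_eq_prime_pow (f := m * 2) (by rw [hF, pow_mul])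
  by_contra hne
  obtain ⟨g, r, t, hg, hrt, rfl, rfl⟩ : ∃ g r t, 0 < g ∧ r.Coprime t ∧ k = g * r ∧ m = g * t := by
    have hg : 0 < k.gcd m := Nat.gcd_pos_of_pos_left _ hk0
    exact ⟨_, _, _, hg, Nat.coprime_div_gcd_div_gcd hg,
      (Nat.mul_div_cancel' (Nat.gcd_dvd_left _ _)).symm,
      (Nat.mul_div_cancel' (Nat.gcd_dvd_right _ _)).symm⟩
  have hr : 0 < r := Nat.pos_of_mul_pos_left hk0
  have hrt' : r < t := Nat.lt_of_mul_lt_mul_left hkm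
  have ht : 3 ≤ t := by
    by_contra hlt
    obtain rfl : t = 2 := by omega
    obtain rfl : r = 1 := by omega
    exact hne (by ring)
  obtain ⟨h, hP⟩ : ∃ h, p ^ g = 2 * h + 1 := hodd.pow
  have hh : 0 < h := by
    have := Nat.one_lt_pow hg.ne' hp.one_lt
    omega
  obtain ⟨R, hR⟩ : ∃ R, R = ∑ i ∈ Finset.range t, (2 * h + 1) ^ i := ⟨_, rfl⟩
  have hq : p ^ (g * t) = 2 * (h * R) + 1 := by
    rw [pow_mul, hP, ← geom_sum_mul_add, hR]
    ring
  have hN : (p ^ (g * t) - 1) / 2 = h * R := by omega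
  have hcard : Fintype.card F - 1 = (p ^ (g * t) + 1) * (p ^ (g * t) - 1) := by
    rw [hF, ← Nat.sq_sub_sq, one_pow]
  have hRh : 2 * h < R := by
    have h2 : ∑ i ∈ Finset.range 2, (2 * h + 1) ^ i ≤ R := by
      rw [hR]
      exact Finset.sum_le_sum_of_subset (Finset.range_subset_range.2 (by omega))
    simp [Finset.sum_range_succ] at h2
    omega
  have hdvd : ∀ a, Fintype.card F - 1 ∣
      ((p ^ (g * t) + 1) * (2 * (p ^ (g * r) - 1))) * a → R ∣ 2 * a := by
    intro a ha
    rw [hcard, mul_assoc] at ha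
    have := Nat.dvd_of_mul_dvd_mul_left (by positivity) ha
    rw [pow_mul, pow_mul, hP] at this
    rw [hR]
    exact geom_sum_dvd_of_pow_sub_one_dvd (by omega) hrt this
  set E := (p ^ (g * t) + 1) * (2 * (p ^ (g * r) - 1)) with hE
  have hT := sum_coeff_of_eval_pow_eq (T := (X - C n) ^ (h * R)) (L := h * R + 1) (E := E) (l := 0)
    (by rw [natDegree_pow, natDegree_X_sub_C]; omega) (fun u hu => by
      have := H (u ^ (p ^ (g * t) + 1)) (pow_ne_zero _ hu) (by
        rw [← pow_mul, add_mul, ← sq, pow_add, ← hF, FiniteField.pow_card, one_mul, pow_succ'])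
      rw [hN, ← pow_mul] at this
      simpa [hE] using this) (h * R - h)
  have hhR : h ≤ h * R := Nat.le_mul_of_pos_right _ (by omega)
  rw [if_neg, Finset.sum_eq_single_of_mem h (by simp; omega), if_pos] at hT
  · have hc : ((X - C n) ^ (h * R)).coeff h = (-n) ^ (h * R - h) * ((h * R).choose h : F) := by
      rw [sub_eq_add_neg, ← C_neg, coeff_X_add_C_pow]
    rw [hc, mul_eq_zero] at hT
    rcases hT with hT | hT
    · exact pow_ne_zero _ (neg_ne_zero.2 hn) hT
    · rw [CharP.cast_eq_zero_iff F p] at hT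
      have hL := Choose.choose_modEq_choose_mod_pow_mul_choose_div_pow (p := p) g (h * R) h
      obtain ⟨R', hR'⟩ : ∃ R', R = R' * (2 * h + 1) + 1 :=
        hR ▸ exists_geom_sum_eq_mul_add_one (by omega)
      have e1 : h * R = (h * R') * (2 * h + 1) + h := by rw [hR']; ring
      have e2 : h * R % (2 * h + 1) = h := by rw [e1, Nat.mul_add_mod_of_lt (by omega)]
      rw [hP, e2, Nat.mod_eq_of_lt (by omega : h < 2 * h + 1),
        Nat.div_eq_of_lt (by omega : h < 2 * h + 1),
        Nat.choose_self, Nat.choose_zero_right] at hL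
      have := hL.symm.trans ((Nat.modEq_zero_iff_dvd).2 hT)
      exact hp.one_lt.ne' (Nat.dvd_one.1 ((Nat.modEq_zero_iff_dvd).1 this))
  · rw [Nat.add_sub_cancel' hhR, hcard, hE, mul_assoc, hq, Nat.add_sub_cancel]
    exact ⟨p ^ (g * r) - 1, by ring⟩
  · intro i hi hih
    split_ifs with hd
    · rw [sub_eq_add_neg, ← C_neg, coeff_X_add_C_pow,
        (CharP.cast_eq_zero_iff F p _).2, mul_zero]
      apply dvd_choose_of_geom_sum_dvd hP hh ht hR (by simp at hi; omega) hih
      have h1 := Int.natCast_dvd_natCast.2 (hdvd _ hd)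
      push_cast [hhR] at h1
      have h2 : 2 * ((i : ℤ) - h) = 2 * (i + (h * R - h)) - R * (2 * h) := by ring
      rw [h2]
      exact h1.sub (dvd_mul_right _ _)
    · rfl
  · intro hd
    have h1 := Int.natCast_dvd_natCast.2 (hdvd _ hd)
    push_cast [hhR] at h1
    have h2 : (R : ℤ) ∣ (2 * h : ℕ) := by
      have : ((2 * h : ℕ) : ℤ) = R * (2 * h) - 2 * (0 + (h * R - h)) := by push_cast; ring
      rw [this]
      exact (dvd_mul_right _ _).sub h1
    have := Nat.le_of_dvd (by omega) (Int.natCast_dvd_natCast.1 h2)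
    omega

open Polynomial in
/-- The coefficients of the power `S = (a X² + b X + c) ^ h` satisfy a linear recurrence, as `S` is a
solution of `(a X² + b X + c) S' = h (2 a X + b) S`; here `2 h = -1`. -/
theorem coeff_quadratic_pow_recurrence {K : Type*} [Field K] {h : ℕ} (hh : (2 * h + 1 : K) = 0)
    (a b c : K) {S : K[X]} (hS : S = (C a * X ^ 2 + C b * X + C c) ^ h) :
    b * S.coeff 0 + 2 * c * S.coeff 1 = 0 ∧
    ∀ i : ℕ, 2 * a * (i + 1) * S.coeff i + b * (2 * i + 3) * S.coeff (i + 1) +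
      2 * c * (i + 2) * S.coeff (i + 2) = 0 := by
  have hpos : h ≠ 0 := by rintro rfl; simp at hh
  have hd : (C a * X ^ 2 + C b * X + C c) * derivative S =
      C (h : K) * (2 * C a * X + C b) * S := by
    obtain ⟨s, rfl⟩ := Nat.exists_eq_succ_of_ne_zero hpos
    rw [hS, derivative_pow]
    simp only [derivative_add, derivative_mul, derivative_C, derivative_X, derivative_one,
      Nat.succ_eq_add_one, Nat.add_sub_cancel, pow_succ, pow_zero]
    ring
  have hC : (2 * C (h : K) + 1 : K[X]) = 0 := by
    have := congrArg C hh
    rwa [C_add, C_mul, C_ofNat, C_1, C_0] at this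
  have ode : C (2 * a) * (X ^ 2 * (X * derivative S)) + C (2 * b) * (X * (X * derivative S)) +
      C (2 * c) * (X * derivative S) + C (2 * a) * (X ^ 2 * S) + C b * (X * S) = 0 := by
    simp only [C_mul, C_ofNat]
    linear_combination 2 * X * hd + X * (2 * C a * X + C b) * S * hC
  have hθ : ∀ i, (X * derivative S).coeff i = i * S.coeff i := by
    rintro (_ | i)
    · simp
    · rw [coeff_X_mul, coeff_derivative]; push_cast; ring
  constructor
  · have := congrArg (coeff · 1) ode
    have hX : ∀ P : K[X], (X * P).coeff 1 = P.coeff 0 := fun P => coeff_X_mul P 0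
    simp only [coeff_add, coeff_C_mul, hθ, coeff_X_pow_mul', coeff_zero] at this
    rw [hX, hX, hθ, if_neg (by omega), if_neg (by omega)] at this
    push_cast at this
    linear_combination this
  · intro i
    have := congrArg (coeff · (i + 2)) ode
    simp only [coeff_add, coeff_C_mul, coeff_X_pow_mul, hθ, coeff_zero,
      show i + 2 = (i + 1) + 1 from rfl, coeff_X_mul] at this
    push_cast at this
    linear_combination this

open Polynomial in
theorem norm_eq_one_of_forall_pow_eq_one {h : ℕ} (hpos : 0 < h)
    (hF : Fintype.card F = ((2 * h + 1) ^ 2) ^ 2) (hchar : (2 * h + 1 : F) = 0)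
    (h5 : h = 2 → (5 : F) = 0)
    {n n' : F} (hn : n ≠ 0) (hn' : n' ≠ 0)
    (H : ∀ y : F, y ^ (h + 1) = 1 → ((y - n) * (1 - n' * y)) ^ h = y ^ h) :
    n * n' = 1 := by
  have h2 : (2 : F) ≠ 0 := by
    intro h2
    rw [h2, zero_mul, zero_add] at hchar
    exact one_ne_zero hchar
  obtain ⟨S, hS⟩ : ∃ S : F[X], S = (C (-n') * X ^ 2 + C (1 + n * n') * X + C (-n)) ^ h := ⟨_, rfl⟩
  obtain ⟨r0, r⟩ := coeff_quadratic_pow_recurrence hchar _ _ _ hS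
  have hcard : Fintype.card F - 1 = (((2 * h + 1) ^ 2 + 1) * (4 * h)) * (h + 1) := by
    rw [hF]
    exact Nat.sub_eq_of_eq_add (by ring)
  have hdeg : S.natDegree < 2 * h + 1 := by
    rw [hS]
    refine Nat.lt_succ_of_le (natDegree_pow_le.trans ?_)
    rw [mul_comm]
    exact Nat.mul_le_mul_right _ natDegree_quadratic_le
  have hcoeff : ∀ i ≤ h, S.coeff i + S.coeff (i + (h + 1)) = if i = h then 1 else 0 := by
    intro i hi
    have := sum_coeff_of_eval_pow_eq (T := S) (L := 2 * h + 2)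
      (E := ((2 * h + 1) ^ 2 + 1) * (4 * h)) (l := h) (by omega) (fun u hu => by
        rw [hS, ← H (u ^ _) (by rw [← pow_mul, ← hcard, FiniteField.pow_card_sub_one_eq_one u hu])]
        simp only [eval_pow, eval_add, eval_mul, eval_C, eval_X]
        congr 1
        ring) (h + 1 - i)
    have hiff : ∀ a, (Fintype.card F - 1 ∣ (((2 * h + 1) ^ 2 + 1) * (4 * h)) * a) ↔ h + 1 ∣ a :=
      fun a => by rw [hcard, Nat.mul_dvd_mul_iff_left (by positivity)]
    simp only [hiff] at this
    rw [Finset.sum_eq_add_of_mem i (i + (h + 1)) (by simp; omega) (by simp; omega) (by omega),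
      if_pos (by rw [Nat.add_sub_cancel' (by omega)]),
      if_pos (by rw [add_right_comm, Nat.add_sub_cancel' (by omega)]; exact ⟨2, by ring⟩)] at this
    · rw [this]
      congr 1
      apply propext
      constructor
      · rintro ⟨c, hc⟩
        have : c < 2 := by
          by_contra! hle
          have := Nat.mul_le_mul_left (h + 1) hle
          omega
        interval_cases c <;> omega
      · rintro rfl
        exact ⟨1, by omega⟩
    · intro j hj hne
      rw [if_neg]
      rintro ⟨c, hc⟩
      simp at hj
      have : c < 3 := by
        by_contra! hle
        have := Nat.mul_le_mul_left (h + 1) hle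
        omega
      interval_cases c <;> omega
  have hc0 : S.coeff 0 ≠ 0 := by
    rw [coeff_zero_eq_eval_zero, hS]
    simp [hn]
  obtain rfl | hh : h = 1 ∨ 2 ≤ h := by omega
  · exfalso
    have h1 := hcoeff 1 le_rfl
    have h3 : S.coeff (1 + (1 + 1)) = 0 := coeff_eq_zero_of_natDegree_lt (by omega)
    rw [h3, hS] at h1
    simp [coeff_C] at h1
    exact h1.elim hn hn'
  · have e0 := hcoeff 0 (by omega)
    have e1 := hcoeff 1 (by omega)
    have e2 : (5 : F) * (S.coeff 2 + S.coeff (2 + (h + 1))) = 0 := by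
      rw [hcoeff 2 hh]
      split_ifs with h
      · rw [h5 h.symm, zero_mul]
      · rw [mul_zero]
    rw [if_neg (by omega), zero_add] at e0
    rw [if_neg (by omega)] at e1
    have r1 := r 0
    have r2 := r (h + 1)
    rw [show 1 + (h + 1) = h + 1 + 1 by ring] at e1
    rw [show 2 + (h + 1) = h + 1 + 2 by ring] at e2
    push_cast at r1 r2
    simp only [zero_add] at r1
    generalize S.coeff (h + 1) = d0 at *
    generalize S.coeff (h + 1 + 1) = d1 at *
    generalize S.coeff (h + 1 + 2) = d2 at *
    have r3 : 3 * n' * S.coeff 0 - 4 * (1 + n * n') * S.coeff 1 + 5 * n * S.coeff 2 = 0 := by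
      linear_combination r2 - (-n' * d0 + (1 + n * n') * d1 - n * d2) * hchar + 3 * n' * e0 -
        4 * (1 + n * n') * e1 + n * e2
    have r4 : 2 * n' * S.coeff 0 = (1 + n * n') * S.coeff 1 := by
      linear_combination 4 * r3 + 5 * r1
    have : (1 - n * n') ^ 2 * S.coeff 0 = 0 := by
      linear_combination (1 + n * n') * r0 - 2 * n * r4
    rw [mul_eq_zero, or_iff_left hc0] at this
    linear_combination -(pow_eq_zero_iff two_ne_zero).1 this

theorem forall_sub_pow_eq_one_iff {p k : ℕ} [Fact p.Prime] (hodd : Odd p) (hk0 : 0 < k)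
    (hF : Fintype.card F = (p ^ (2 * k)) ^ 2) {n : F} (hn : n ≠ 0) :
    (∀ s : F, s ≠ 0 → s ^ p ^ (2 * k) = s →
      (s ^ (2 * (p ^ k - 1)) - n) ^ ((p ^ (2 * k) - 1) / 2) = 1) ↔
      p ^ k % 4 = 1 ∧ n ^ ((p ^ k + 1) / 2) = -1 := by
  have hp := Fact.out (p := p.Prime)
  have hchar : CharP F p := charP_of_card_eq_prime_pow (f := 2 * k * 2) (by rw [hF, ← pow_mul])
  obtain ⟨h, hQ⟩ : ∃ h, p ^ k = 2 * h + 1 := hodd.pow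
  have hpos : 0 < h := by
    have := Nat.one_lt_pow hk0.ne' hp.one_lt
    omega
  have hq : p ^ (2 * k) = (2 * h + 1) ^ 2 := by rw [mul_comm, pow_mul, hQ]
  have hcast : (2 * h + 1 : F) = 0 := by
    have : ((p ^ k : ℕ) : F) = 0 := by simp [hk0.ne']
    rw [hQ] at this
    exact_mod_cast this
  have hneg : (-1 : F) ≠ 1 := by
    intro h1
    have h2 : (2 : F) = 0 := by linear_combination -h1
    rw [h2, zero_mul, zero_add] at hcast
    exact one_ne_zero hcast
  have hfrob : ∀ x y : F, (x - y) ^ (2 * h + 1) = x ^ (2 * h + 1) - y ^ (2 * h + 1) := by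
    rw [← hQ]
    exact fun x y => sub_pow_char_pow x y k
  have hN : (p ^ (2 * k) - 1) / 2 = h * (2 * h + 2) := by
    rw [hq, show (2 * h + 1) ^ 2 = 2 * (h * (2 * h + 2)) + 1 by ring]
    omega
  have hcard : Fintype.card F - 1 =
      (h + 1) * ((p ^ (2 * k) + 1) * (2 * (p ^ k - 1))) := by
    rw [hF, hq, hQ, Nat.add_sub_cancel]
    exact Nat.sub_eq_of_eq_add (by ring)
  have hM : (p ^ k + 1) / 2 = h + 1 := by omega
  have hsub : (∀ s : F, s ≠ 0 → s ^ p ^ (2 * k) = s →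
      (s ^ (2 * (p ^ k - 1)) - n) ^ ((p ^ (2 * k) - 1) / 2) = 1) ↔
      ∀ y : F, y ^ (h + 1) = 1 → (y - n) ^ (h * (2 * h + 2)) = 1 := by
    rw [hN]
    constructor
    · intro H y hy
      obtain ⟨u, hu, rfl⟩ := exists_pow_eq_of_pow_eq_one hcard hy
      rw [pow_mul u]
      refine H _ (pow_ne_zero _ hu) ?_
      rw [← pow_mul, add_mul, ← sq, pow_add, ← hF, FiniteField.pow_card, one_mul, pow_succ']
    · intro H s hs hsq
      refine H _ ?_
      rw [← pow_mul, hQ, Nat.add_sub_cancel]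
      rw [hq] at hsq
      apply mul_right_cancel₀ hs
      rw [one_mul, ← pow_succ]
      convert hsq using 2
      ring
  have hnorm : ∀ y : F, y ^ (h + 1) = 1 →
      (y - n) ^ (2 * h + 2) * y = (y - n) * (1 - n ^ (2 * h + 1) * y) := by
    intro y hy
    have hy2 : y ^ (2 * h + 1) * y = 1 := by
      rw [← pow_succ, show 2 * h + 1 + 1 = (h + 1) * 2 by ring, pow_mul, hy, one_pow]
    rw [pow_succ, hfrob]
    linear_combination (y - n) * hy2
  have hval : n ^ (h + 1) = -1 → ∀ y : F, y ^ (h + 1) = 1 →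
      (y - n) ^ (h * (2 * h + 2)) = (-1) ^ h := by
    intro hnM y hy
    have hyn : y - n ≠ 0 := by
      rw [sub_ne_zero]
      rintro rfl
      exact hneg (hnM.symm.trans hy)
    have hn2 : n * n ^ (2 * h + 1) = 1 := by
      rw [← pow_succ', show 2 * h + 1 + 1 = (h + 1) * 2 by ring, pow_mul, hnM, neg_one_sq]
    have h1 : (y - n) ^ (2 * h) * (y * n) = -1 := by
      have h2 : (y - n) ^ (2 * h + 2) * (y * n) = -(y - n) ^ 2 := by
        linear_combination n * hnorm y hy - (y - n) * y * hn2
      apply mul_right_cancel₀ (pow_ne_zero 2 hyn)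
      rw [pow_add] at h2
      linear_combination h2
    have h3 := congrArg (· ^ (h + 1)) h1
    simp only [mul_pow, hy, hnM, ← pow_mul] at h3
    rw [show h * (2 * h + 2) = 2 * h * (h + 1) by ring]
    rw [pow_succ (-1 : F)] at h3
    linear_combination -h3
  rw [hsub, hM]
  have h4 : p ^ k % 4 = 1 ↔ Even h := by
    rw [hQ, Nat.even_iff]; omega
  rw [h4]
  constructor
  · intro H
    have hnn : n * n ^ (2 * h + 1) = 1 := by
      refine norm_eq_one_of_forall_pow_eq_one hpos (by rw [hF, hq]) hcast ?_ hn
        (pow_ne_zero _ hn) ?_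
      · rintro rfl
        linear_combination hcast
      · intro y hy
        rw [← hnorm y hy, mul_pow, ← pow_mul, mul_comm _ h, H y hy, one_mul]
    have hsq : (n ^ (h + 1)) ^ 2 = 1 := by
      rw [← hnn]; ring
    have hnM : n ^ (h + 1) = -1 := by
      refine (sq_eq_one_iff.1 hsq).resolve_left ?_
      intro h1
      have := H n h1
      rw [sub_self, zero_pow (by positivity)] at this
      exact zero_ne_one this
    refine ⟨?_, hnM⟩
    by_contra hodd'
    have := H 1 (one_pow _)
    rw [hval hnM 1 (one_pow _), (Nat.not_even_iff_odd.1 hodd').neg_one_pow] at this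
    exact hneg this
  · rintro ⟨he, hnM⟩ y hy
    rw [hval hnM y hy, he.neg_one_pow]

/-- Whether `v + v ^ q = 2 * t` has a solution with `v ^ (q + 1) = u ^ (q + 1)` is decided by the
quadratic character of `t ^ 2 - u ^ (q + 1)` in the subfield with `q` elements. -/
theorem exists_mul_pow_add_eq_two_mul_iff {q : ℕ} (hq : Odd q) (hF : Fintype.card F = q ^ 2)
    (hadd : ∀ x y : F, (x + y) ^ q = x ^ q + y ^ q) (h2 : (2 : F) ≠ 0) {u : F} (hu : u ≠ 0)
    (t : F) :
    (∃ x e : F, x * e = u ∧ x * e ^ q + x ^ q * e = 2 * t) ↔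
      t ^ q = t ∧ (t ^ 2 - u ^ (q + 1)) ^ ((q - 1) / 2) ≠ 1 := by
  have hq2 : ∀ x : F, (x ^ q) ^ q = x := fun x => by
    rw [← pow_mul, ← sq, ← hF, FiniteField.pow_card]
  have hneg : ∀ x : F, (-x) ^ q = -x ^ q := hq.neg_pow
  have htwo : (2 : F) ^ q = 2 := by
    rw [← one_add_one_eq_two, hadd, one_pow]
  obtain ⟨r, hr⟩ := hq
  have hr1 : (q - 1) / 2 = r := by omega
  rw [hr1]
  have hcard : Fintype.card F - 1 = (q + 1) * (q - 1) := by
    rw [hF, ← Nat.sq_sub_sq, one_pow]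
  have hrpos : r ≠ 0 := by
    rintro rfl
    have : Fintype.card F = 1 := by rw [hF, hr]; rfl
    exact (Fintype.one_lt_card (α := F)).ne' this
  constructor
  · rintro ⟨x, e, rfl, hxe⟩
    obtain ⟨v, hv⟩ : ∃ v, v = x * e ^ q := ⟨_, rfl⟩
    have hvq : v ^ q = x ^ q * e := by rw [hv, mul_pow, hq2]
    rw [← hv, ← hvq] at hxe
    have ht : t ^ q = t := by
      apply mul_left_cancel₀ h2
      have := congrArg (· ^ q) hxe
      simp only [hadd, hq2, mul_pow, htwo] at this
      rw [← this, ← hxe, add_comm]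
    refine ⟨ht, fun h1 => ?_⟩
    have hδ : (t ^ 2 - (x * e) ^ (q + 1)) = (v - t) ^ 2 := by
      have : (x * e) ^ (q + 1) = v * v ^ q := by rw [hvq, hv]; ring
      rw [this]
      linear_combination -v * hxe
    rw [hδ, ← pow_mul] at h1
    have h3 : (v - t) ^ q = -(v - t) := by
      rw [sub_eq_add_neg, hadd, hneg, ht]
      linear_combination hxe
    rw [hr, pow_succ, h1, one_mul] at h3
    have h4 : v - t = 0 := by
      apply mul_left_cancel₀ h2
      linear_combination h3
    rw [h4, zero_pow (by positivity)] at h1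
    exact zero_ne_one h1
  · rintro ⟨ht, hne⟩
    obtain ⟨δ, hδ, hδq⟩ : ∃ δ : F, δ ^ 2 = t ^ 2 - u ^ (q + 1) ∧ δ ^ q = -δ := by
      set D := t ^ 2 - u ^ (q + 1) with hD
      by_cases hD0 : D = 0
      · exact ⟨0, by simp [hD0], by simp [hr]⟩
      · have hDq : D ^ q = D := by
          rw [hD, sub_eq_add_neg, hadd, hneg, ← pow_mul, mul_comm 2 q, pow_mul, ht,
            pow_succ u, mul_pow, hq2]
          ring
        have hD1 : (D ^ r) ^ 2 = 1 := by
          apply mul_right_cancel₀ hD0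
          rw [← pow_mul, one_mul, ← pow_succ, mul_comm r 2, ← hr, hDq]
        have hDr := (sq_eq_one_iff.1 hD1).resolve_left hne
        have hc : Fintype.card F - 1 = (r * (q + 1)) * 2 := by
          rw [hcard, hr, Nat.add_sub_cancel]; ring
        obtain ⟨δ, -, hδ⟩ := exists_pow_eq_of_pow_eq_one hc (w := D) (by
          rw [pow_mul, hDr]
          exact Even.neg_one_pow ⟨r + 1, by omega⟩)
        refine ⟨δ, hδ, ?_⟩
        rw [hr, pow_succ, pow_mul, hδ, hDr, neg_one_mul]
    have hvq : (t + δ) ^ q = t - δ := by rw [hadd, ht, hδq]; ring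
    obtain ⟨e, he, hew⟩ := exists_pow_eq_of_pow_eq_one hcard (w := (t + δ) / u) (by
      rw [div_pow, div_eq_one_iff_eq (pow_ne_zero _ hu), pow_succ, hvq]
      linear_combination -hδ)
    have heq : e ^ q = (t + δ) / u * e := by
      rw [← hew, ← pow_succ, Nat.sub_add_cancel (by omega)]
    have h1 : u / e * e ^ q = t + δ := by
      rw [heq]; field_simp
    refine ⟨u / e, e, div_mul_cancel₀ _ he, ?_⟩
    have h3 : (u / e) ^ q * e = (t + δ) ^ q := by
      rw [← h1, mul_pow, hq2]
    rw [h3, h1, hvq]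
    ring

end FiniteField

/-- for `ℓ(x) = (b·x^q + c·x)^{p^k}` with `N(b) ≠ N(c)` and `0 < k < m`,
the function `x^{q+1} + ℓ(x²)` is planar on `F_{q²}` iff `p^k ≡ 1 (mod 4)`, `m = 2k`
and `N(b − c^q)^{(p^k+1)/2} = −(N(b) − N(c))^{p^k+1}`. -/
theorem planar_iff_monomial_case
    (p m k : ℕ) (hp : p.Prime) (hodd : Odd p) (hm : 0 < m) (hk0 : 0 < k) (hkm : k < m)
    (q : ℕ) (hq : q = p ^ m)
    (F : Type*) [Field F] [Fintype F] (hF : Fintype.card F = q ^ 2)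
    (b c : F) (hbc : b ^ (q + 1) ≠ c ^ (q + 1))
    (ℓ : F → F) (hℓ : ∀ x, ℓ x = (b * x ^ q + c * x) ^ p ^ k)
    (f : F → F) (hf : ∀ x, f x = x ^ (q + 1) + ℓ (x ^ 2)) :
    (∀ e : F, e ≠ 0 → Function.Bijective (fun x => f (x + e) - f x)) ↔
      (p ^ k % 4 = 1 ∧ m = 2 * k ∧
        ((b - c ^ q) ^ (q + 1)) ^ ((p ^ k + 1) / 2) =
          -(b ^ (q + 1) - c ^ (q + 1)) ^ (p ^ k + 1)) := by
  have : Fact p.Prime := ⟨hp⟩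
  have hchar : CharP F p := charP_of_card_eq_prime_pow (f := m * 2) (by rw [hF, hq, pow_mul])
  have hadd : ∀ x y : F, (x + y) ^ q = x ^ q + y ^ q := fun x y => by
    rw [hq]; exact add_pow_char_pow x y p m
  have hsub : ∀ x y : F, (x - y) ^ q = x ^ q - y ^ q := fun x y => by
    rw [hq]; exact sub_pow_char_pow x y m
  have haddk : ∀ x y : F, (x + y) ^ p ^ k = x ^ p ^ k + y ^ p ^ k := fun x y =>
    add_pow_char_pow x y p k
  have hqodd : Odd q := hq ▸ hodd.pow
  have hq2 : ∀ x : F, (x ^ q) ^ q = x := fun x => by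
    rw [← pow_mul, ← sq, ← hF, FiniteField.pow_card]
  have h2 : (2 : F) ≠ 0 := by
    have h2 : ((2 : ℕ) : F) ≠ 0 := by
      rw [Ne, CharP.cast_eq_zero_iff F p]
      intro h
      rw [(Nat.prime_dvd_prime_iff_eq hp Nat.prime_two).1 h] at hodd
      exact absurd hodd (by decide)
    exact_mod_cast h2
  have hℓadd : ∀ x y, ℓ (x + y) = ℓ x + ℓ y := fun x y => by
    rw [hℓ, hℓ, hℓ, hadd, ← haddk]
    congr 1
    ring
  have hℓ2 : ∀ x, ℓ (2 * x) = 2 * ℓ x := fun x => by rw [two_mul, hℓadd, two_mul]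
  have hℓ0 : ℓ 0 = 0 := by simpa using hℓadd 0 0
  have hinj : Function.Injective (fun x : F => x ^ p ^ k) := by
    have := (iterateFrobenius F p k).injective
    simpa [Function.Injective, iterateFrobenius_def] using this
  -- the polarization of `f`
  have hpol : ∀ x e, f (x + e) - f x = (x * e ^ q + x ^ q * e + 2 * ℓ (x * e)) + f e := by
    intro x e
    rw [hf, hf, hf, show (x + e) ^ 2 = x ^ 2 + 2 * (x * e) + e ^ 2 by ring, hℓadd, hℓadd, hℓ2,
      pow_succ, hadd]
    ring
  have hplanar : (∀ e : F, e ≠ 0 → Function.Bijective (fun x => f (x + e) - f x)) ↔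
      ∀ u : F, u ≠ 0 → ¬ ∃ x e : F, x * e = u ∧ x * e ^ q + x ^ q * e = 2 * -ℓ u := by
    constructor
    · rintro H u hu ⟨x, e, rfl, hxe⟩
      have he := right_ne_zero_of_mul hu
      refine left_ne_zero_of_mul hu ((H e he).1 ?_)
      simp only [hpol, zero_mul, hℓ0, hxe]
      simp [zero_pow hqodd.pos.ne']
    · intro H e he
      refine Finite.injective_iff_bijective.1 fun x y hxy => ?_
      by_contra hne
      refine H _ (mul_ne_zero (sub_ne_zero.2 hne) he) ⟨_, e, rfl, ?_⟩
      simp only [hpol] at hxy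
      have h3 : ℓ (x * e) = ℓ ((x - y) * e) + ℓ (y * e) := by
        rw [← hℓadd]; congr 1; ring
      rw [hsub]
      linear_combination hxy - 2 * h3
  set Δ := b ^ (q + 1) - c ^ (q + 1) with hΔ
  have hΔ0 : Δ ≠ 0 := sub_ne_zero.2 hbc
  have hΔq : Δ ^ q = Δ := by
    rw [hΔ, hsub, pow_succ, pow_succ, mul_pow, mul_pow, hq2, hq2, mul_comm b, mul_comm c]
  obtain ⟨d, hd⟩ : ∃ d, d = (b - c ^ q) / Δ := ⟨_, rfl⟩
  have hdq : d ^ q = (b ^ q - c) / Δ := by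
    rw [hd, div_pow, hsub, hq2, hΔq]
  have hbd : b * d ^ q + c * d = 1 := by
    rw [hdq, hd]
    field_simp
    rw [hΔ]
    ring
  have hd0 : d ≠ 0 := by
    rintro rfl
    simp [zero_pow hqodd.pos.ne'] at hbd
  have hℓs : ∀ s : F, s ^ q = s → ℓ (s * d) = s ^ p ^ k := fun s hs => by
    rw [hℓ, mul_pow, hs]
    congr 1
    linear_combination s * hbd
  have hfix : ∀ u : F, (ℓ u) ^ q = ℓ u → ∃ s : F, s ^ q = s ∧ u = s * d := by
    intro u hu
    have hs : (b * u ^ q + c * u) ^ q = b * u ^ q + c * u := by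
      apply hinj
      rw [hℓ] at hu
      simpa [← pow_mul, mul_comm] using hu
    refine ⟨_, hs, ?_⟩
    rw [hd, mul_div_assoc', eq_div_iff hΔ0]
    rw [hadd, mul_pow, mul_pow, hq2] at hs
    rw [hΔ]
    linear_combination b * hs
  have hchar_iff : (∀ u : F, u ≠ 0 →
        ¬ ∃ x e : F, x * e = u ∧ x * e ^ q + x ^ q * e = 2 * -ℓ u) ↔
      ∀ s : F, s ≠ 0 → s ^ q = s →
        (s ^ (2 * (p ^ k - 1)) - d ^ (q + 1)) ^ ((q - 1) / 2) = 1 := by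
    have hval : ∀ s : F, s ≠ 0 → s ^ q = s →
        ((-ℓ (s * d)) ^ 2 - (s * d) ^ (q + 1)) ^ ((q - 1) / 2) =
          (s ^ (2 * (p ^ k - 1)) - d ^ (q + 1)) ^ ((q - 1) / 2) := by
      intro s hs hsq
      have h1 : (s ^ 2) ^ ((q - 1) / 2) = 1 := by
        rw [← pow_mul, Nat.mul_div_cancel' (hqodd.tsub_odd odd_one).two_dvd]
        apply mul_right_cancel₀ hs
        rw [← pow_succ, Nat.sub_add_cancel (show 1 ≤ q from hqodd.pos), hsq, one_mul]
      rw [hℓs s hsq, ← one_mul ((s ^ (2 * (p ^ k - 1)) - d ^ (q + 1)) ^ ((q - 1) / 2)), ← h1,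
        ← mul_pow]
      congr 1
      have h3 : s ^ p ^ k = s * s ^ (p ^ k - 1) := by
        rw [← pow_succ', Nat.sub_add_cancel (show 1 ≤ p ^ k from pow_pos hp.pos k)]
      rw [h3, mul_pow s d, pow_succ s, hsq]
      ring
    have hneg : ∀ u, (-ℓ u) ^ q = -ℓ u ↔ (ℓ u) ^ q = ℓ u := fun u => by
      rw [hqodd.neg_pow, neg_inj]
    constructor
    · intro H s hs hsq
      have := H (s * d) (mul_ne_zero hs hd0)
      rw [FiniteField.exists_mul_pow_add_eq_two_mul_iff hqodd hF hadd h2 (mul_ne_zero hs hd0),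
        hval s hs hsq, hneg] at this
      by_contra hne
      refine this ⟨?_, hne⟩
      rw [hℓs s hsq, ← pow_mul, mul_comm, pow_mul, hsq]
    · intro H u hu
      rw [FiniteField.exists_mul_pow_add_eq_two_mul_iff hqodd hF hadd h2 hu, hneg]
      rintro ⟨hu1, hu2⟩
      obtain ⟨s, hsq, rfl⟩ := hfix u hu1
      have hs := left_ne_zero_of_mul hu
      exact hu2 (by rw [hval s hs hsq, H s hs hsq])
  have hn0 : d ^ (q + 1) ≠ 0 := pow_ne_zero _ hd0
  have hfinal : (d ^ (q + 1)) ^ ((p ^ k + 1) / 2) = -1 ↔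
      ((b - c ^ q) ^ (q + 1)) ^ ((p ^ k + 1) / 2) = -Δ ^ (p ^ k + 1) := by
    have h1 : b - c ^ q = d * Δ := by rw [hd, div_mul_cancel₀ _ hΔ0]
    have h3 : (Δ ^ (q + 1)) ^ ((p ^ k + 1) / 2) = Δ ^ (p ^ k + 1) := by
      rw [pow_succ, hΔq, ← sq, ← pow_mul,
        Nat.mul_div_cancel' (Odd.add_odd hodd.pow odd_one).two_dvd]
    rw [h1, mul_pow, mul_pow, h3, ← neg_one_mul (Δ ^ (p ^ k + 1)),
      mul_left_inj' (pow_ne_zero _ hΔ0)]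
  rw [hplanar, hchar_iff, ← hfinal]
  have hcond : m = 2 * k → ((∀ s : F, s ≠ 0 → s ^ q = s →
        (s ^ (2 * (p ^ k - 1)) - d ^ (q + 1)) ^ ((q - 1) / 2) = 1) ↔
      p ^ k % 4 = 1 ∧ (d ^ (q + 1)) ^ ((p ^ k + 1) / 2) = -1) := by
    rintro rfl
    rw [hq] at hF hn0 ⊢
    exact FiniteField.forall_sub_pow_eq_one_iff hodd hk0 hF hn0
  constructor
  · intro H
    have hmk : m = 2 * k := by
      rw [hq] at hF hn0 H
      exact FiniteField.eq_two_mul_of_forall_pow_eq_one hodd hk0 hkm hF hn0 H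
    exact ⟨((hcond hmk).1 H).1, hmk, ((hcond hmk).1 H).2⟩
  · rintro ⟨h4, hmk, hn⟩
    exact (hcond hmk).2 ⟨h4, hn⟩
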